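/- arXiv:0808.3424 — 3 statements merged into one kernel-verified Lean document; each statement's English description precedes it below -/
import Mathlib

section
/- Let A be a unital infinite-dimensional simple C*-algebra and a a nonzero positive element of A. Then the hereditary subalgebra generated by a contains a positive element b with 0 ≤ b ≤ 1 whose spectrum is infinite; consequently for every n ≥ 1 there exist n nonzero mutually orthogonal positive elements b_1,...,b_n in the hereditary subalgebra generated by a. -/
/-- The hereditary subalgebra of `A` generated by a positive element `a`:
the norm closure of `a * A * a`. -/
def hereditary {A : Type*} [NormedRing A] (a : A) : Set A :=
  closure {x : A | ∃ y : A, x = a * y * a}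

section helpers
variable {A : Type*} [CStarAlgebra A] [PartialOrder A] [StarOrderedRing A]

theorem hh_proj (z : A) (hz : 0 ≤ z) (hz0 : z ≠ 0) (hf : (spectrum ℂ z).Finite) :
    ∃ (l : ℝ) (e : A), l ≠ 0 ∧ IsStarProjection e ∧ e ≠ 0 ∧ z * e = l • e ∧ e * z = l • e := by
  have : Nontrivial A := ⟨z, 0, hz0⟩
  have hsa : IsSelfAdjoint z := .of_nonneg hz
  have hfr : (spectrum ℝ z).Finite := by
    have h := hsa.spectrumRestricts.algebraMap_image
    rw [← h] at hf
    exact hf.of_finite_image (algebraMap ℝ ℂ).injective.injOn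
  have hc : ∀ f : ℝ → ℝ, ContinuousOn f (spectrum ℝ z) := fun f => hfr.continuousOn f
  set l := ‖z‖ with hl
  have hl0 : l ≠ 0 := by simpa [hl] using hz0
  have hmem : l ∈ spectrum ℝ z := CStarAlgebra.norm_mem_spectrum_of_nonneg hz
  let f : ℝ → ℝ := fun t => if t = l then 1 else 0
  refine ⟨l, cfc f z, hl0, ⟨?_, IsSelfAdjoint.cfc⟩, ?_, ?_, ?_⟩
  · rw [IsIdempotentElem, ← cfc_mul f f z (hc _) (hc _)]
    congr 1; ext t; simp only [f]; split_ifs <;> simp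
  · intro h
    have := norm_apply_le_norm_cfc f z hmem (hc _) hsa
    rw [h] at this
    simp [f] at this
    linarith
  · conv_lhs => enter [1]; rw [← cfc_id ℝ z]
    rw [← cfc_mul _ f z (hc _) (hc _), ← cfc_const_mul l f z (hc _)]
    congr 1; ext t; simp only [f, id]; split_ifs with h <;> simp [h]
  · conv_lhs => enter [2]; rw [← cfc_id ℝ z]
    rw [← cfc_mul f _ z (hc _) (hc _), ← cfc_const_mul l f z (hc _)]
    congr 1; ext t; simp only [f, id]; split_ifs with h <;> simp [h]

theorem hh_findim (hsimple : ∀ I : TwoSidedIdeal A, IsClosed (I : Set A) → I = ⊥ ∨ I = ⊤)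
    (q : A) (hq0 : q ≠ 0) (hq : ∀ x, ∃ c : ℂ, q * x * q = c • q) :
    FiniteDimensional ℂ A := by
  let S : Set A := {z | ∃ x y, z = x * q * y}
  let J : Submodule ℂ A := Submodule.span ℂ S
  have hl : ∀ x y, y ∈ J → x * y ∈ J := by
    intro x y hy
    induction hy using Submodule.span_induction with
    | mem z hz =>
      obtain ⟨u, v, rfl⟩ := hz
      exact Submodule.subset_span ⟨x * u, v, by simp only [mul_assoc]⟩
    | zero => simp
    | add a b _ _ ha hb => rw [mul_add]; exact J.add_mem ha hb
    | smul c a _ ha => rw [mul_smul_comm]; exact J.smul_mem c ha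
  have hr : ∀ x y, x ∈ J → x * y ∈ J := by
    intro x y hy
    induction hy using Submodule.span_induction with
    | mem z hz =>
      obtain ⟨u, v, rfl⟩ := hz
      exact Submodule.subset_span ⟨u, v * y, by simp only [mul_assoc]⟩
    | zero => simp
    | add a b _ _ ha hb => rw [add_mul]; exact J.add_mem ha hb
    | smul c a _ ha => rw [smul_mul_assoc]; exact J.smul_mem c ha
  let K := J.topologicalClosure
  have hK : (K : Set A) = closure (J : Set A) := J.topologicalClosure_coe
  let I : TwoSidedIdeal A := TwoSidedIdeal.mk' (K : Set A) K.zero_mem K.add_mem K.neg_mem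
    (by
      intro x y hy
      rw [hK] at hy ⊢
      exact map_mem_closure (f := fun y => x * y) (by fun_prop) hy (fun y hy => hl x y hy))
    (by
      intro x y hy
      rw [hK] at hy ⊢
      exact map_mem_closure (f := fun x => x * y) (by fun_prop) hy (fun x hx => hr x y hx))
  have hI : (I : Set A) = K := TwoSidedIdeal.coe_mk' ..
  have hqI : q ∈ (I : Set A) := by
    rw [hI]
    exact J.le_topologicalClosure (Submodule.subset_span ⟨1, 1, by simp⟩)
  have h1 : (1 : A) ∈ closure (J : Set A) := by
    rw [← hK, ← hI]
    rcases hsimple I (by rw [hI]; exact J.isClosed_topologicalClosure) with h | h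
    · rw [h] at hqI
      exact absurd ((TwoSidedIdeal.mem_bot A).1 hqI) hq0
    · rw [h]; trivial
  obtain ⟨y, hyJ, hy⟩ := Metric.mem_closure_iff.1 h1 1 one_pos
  have hu : IsUnit y := by
    rw [dist_eq_norm] at hy
    simpa using isUnit_one_sub_of_norm_lt_one hy
  have h1J : (1 : A) ∈ J := by
    obtain ⟨v, hv⟩ := hu.exists_left_inv
    rw [← hv]; exact hl _ _ hyJ
  obtain ⟨T, hTS, hT⟩ := Submodule.mem_span_finite_of_mem_span h1J
  have hTS' : ∀ t : T, ∃ x y, (t : A) = x * q * y := fun t => hTS t.2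
  choose X Y hXY using hTS'
  let F : Submodule ℂ A := Submodule.span ℂ (Set.range fun p : T × T => X p.1 * q * Y p.2)
  have key : ∀ z, ∀ u ∈ Submodule.span ℂ (T : Set A), ∀ v ∈ Submodule.span ℂ (T : Set A),
      u * z * v ∈ F := by
    intro z u hu v hv
    induction hu using Submodule.span_induction with
    | zero => simp
    | add a b _ _ ha hb => rw [add_mul, add_mul]; exact F.add_mem ha hb
    | smul c a _ ha => rw [smul_mul_assoc, smul_mul_assoc]; exact F.smul_mem c ha
    | mem s hs =>
      induction hv using Submodule.span_induction with
      | zero => simp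
      | add a b _ _ ha hb => rw [mul_add]; exact F.add_mem ha hb
      | smul c a _ ha => rw [mul_smul_comm]; exact F.smul_mem c ha
      | mem t ht =>
        have e1 := hXY ⟨s, hs⟩
        have e2 := hXY ⟨t, ht⟩
        simp only at e1 e2
        obtain ⟨c, hc⟩ := hq (Y ⟨s, hs⟩ * z * X ⟨t, ht⟩)
        have : s * z * t = c • (X ⟨s, hs⟩ * q * Y ⟨t, ht⟩) := by
          calc s * z * t = X ⟨s, hs⟩ * (q * (Y ⟨s, hs⟩ * z * X ⟨t, ht⟩) * q) * Y ⟨t, ht⟩ := by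
                conv_lhs => rw [e1, e2]
                simp only [mul_assoc]
            _ = _ := by rw [hc]; simp
        rw [this]
        exact F.smul_mem _ (Submodule.subset_span ⟨(⟨s, hs⟩, ⟨t, ht⟩), rfl⟩)
  have hF : F = ⊤ := by
    rw [eq_top_iff]
    intro z _
    simpa using key z 1 hT 1 hT
  have : FiniteDimensional ℂ F := FiniteDimensional.span_of_finite ℂ (Set.finite_range _)
  rw [hF] at this
  exact Module.finite_def.2 ((Submodule.fg_top _).1 (Module.finite_def.1 this) |> fun h => h)

/-- scalar compression from scalar positive compressions -/
theorem hh_scalar (q : A) (hq : IsStarProjection q)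
    (h : ∀ z, 0 ≤ z → q * z = z → z * q = z → ∃ c : ℂ, z = c • q) (x : A) :
    ∃ c : ℂ, q * x * q = c • q := by
  have hqq : q * q = q := hq.isIdempotentElem
  have hsa : ∀ y : A, IsSelfAdjoint y → ∃ c : ℂ, q * y * q = c • q := by
    intro y hy
    have h0 : 0 ≤ y + algebraMap ℝ A ‖y‖ := by
      have := hy.neg_algebraMap_norm_le_self
      exact neg_le_iff_add_nonneg.1 this
    have h1 : 0 ≤ q * (y + algebraMap ℝ A ‖y‖) * q :=
      hq.isSelfAdjoint.conjugate_nonneg h0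
    obtain ⟨c, hc⟩ := h _ h1 (by simp only [← mul_assoc, hqq]) (by simp only [mul_assoc, hqq])
    refine ⟨c - (‖y‖ : ℂ), ?_⟩
    rw [sub_smul, ← hc, mul_add, add_mul]
    have : q * algebraMap ℝ A ‖y‖ * q = (‖y‖ : ℂ) • q := by
      rw [Algebra.algebraMap_eq_smul_one]
      simp [hqq]
    rw [this]; simp
  obtain ⟨c, hc⟩ := hsa _ (realPart x).2
  obtain ⟨d, hd⟩ := hsa _ (imaginaryPart x).2
  refine ⟨c + Complex.I * d, ?_⟩
  conv_lhs => rw [← realPart_add_I_smul_imaginaryPart x]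
  rw [mul_add, add_mul, hc, mul_smul_comm, smul_mul_assoc, hd, add_smul, mul_smul]

/-- descending chain gives an element with infinite spectrum -/
theorem hh_chain (p : A) (Q : ℕ → A) (hQ : ∀ n, IsStarProjection (Q n))
    (hp : ∀ n, p * Q n = Q n)
    (hs : ∀ n, Q (n+1) * Q n = Q (n+1)) (hne : ∀ n, Q (n+1) ≠ Q n) :
    ∃ b, 0 ≤ b ∧ p * b = b ∧ (spectrum ℂ b).Infinite := by
  have hle : ∀ m n, m ≤ n → Q n * Q m = Q n := by
    intro m n h
    induction n, h using Nat.le_induction with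
    | base => exact (hQ m).isIdempotentElem
    | succ n _ ih => rw [← hs n, mul_assoc, ih]
  have hle' : ∀ m n, m ≤ n → Q m * Q n = Q n := by
    intro m n h
    have := congrArg star (hle m n h)
    rwa [star_mul, (hQ n).isSelfAdjoint.star_eq, (hQ m).isSelfAdjoint.star_eq] at this
  let d : ℕ → A := fun n => Q n - Q (n+1)
  have hd0 : ∀ n, d n ≠ 0 := fun n h => hne n (sub_eq_zero.1 h).symm
  have hdi : ∀ n, d n * d n = d n := by
    intro n
    simp only [d, mul_sub, sub_mul, hle n (n+1) (by omega), hle' n (n+1) (by omega),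
      hle n n le_rfl, hle (n+1) (n+1) le_rfl]
    abel
  have hdo : ∀ m n, m ≠ n → d m * d n = 0 := by
    intro m n h
    rcases lt_or_gt_of_ne h with h | h
    · simp only [d, mul_sub, sub_mul, hle' m n (by omega), hle' (m+1) n (by omega),
        hle' m (n+1) (by omega), hle' (m+1) (n+1) (by omega)]
      abel
    · simp only [d, mul_sub, sub_mul, hle n m (by omega), hle (n+1) m (by omega),
        hle n (m+1) (by omega), hle (n+1) (m+1) (by omega)]
      abel
  have hdp : ∀ n, IsStarProjection (d n) := fun n =>
    ⟨hdi n, (hQ n).isSelfAdjoint.sub (hQ (n+1)).isSelfAdjoint⟩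
  have hdpos : ∀ n, 0 ≤ d n := fun n => by
    have := star_mul_self_nonneg (d n)
    rwa [(hdp n).isSelfAdjoint.star_eq, hdi] at this
  have hsum : Summable (fun n : ℕ => ((1/2 : ℝ)^n) • d n) := by
    refine Summable.of_norm_bounded (g := fun n : ℕ => (1/2 : ℝ)^n) summable_geometric_two ?_
    intro n
    rw [norm_smul]
    have := (hdp n).norm_le
    have h2 : ‖((1/2 : ℝ)^n)‖ = (1/2)^n := by simp
    rw [h2]
    exact mul_le_of_le_one_right (by positivity) this
  refine ⟨∑' n : ℕ, ((1/2 : ℝ)^n) • d n, ?_, ?_, ?_⟩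
  · exact tsum_nonneg fun n => smul_nonneg (by positivity) (hdpos n)
  · rw [← hsum.tsum_mul_left]
    congr 1; ext n
    simp only [d, mul_smul_comm, mul_sub, hp]
  · set b := ∑' n : ℕ, ((1/2 : ℝ)^n) • d n with hb
    have hbd : ∀ k, b * d k = (((1/2 : ℝ)^k : ℝ) : ℂ) • d k := by
      intro k
      rw [hb, ← hsum.tsum_mul_right, tsum_eq_single k]
      · rw [smul_mul_assoc, hdi]; exact (Complex.coe_smul _ _).symm
      · intro n hn
        rw [smul_mul_assoc, hdo n k hn, smul_zero]
    have hmem : ∀ k : ℕ, (((1/2 : ℝ)^k : ℝ) : ℂ) ∈ spectrum ℂ b := by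
      intro k
      rw [spectrum.mem_iff]
      intro hu
      apply hd0 k
      have : (algebraMap ℂ A (((1/2 : ℝ)^k : ℝ) : ℂ) - b) * d k = 0 := by
        rw [sub_mul, hbd, Algebra.algebraMap_eq_smul_one, smul_mul_assoc, one_mul, sub_self]
      exact hu.mul_right_eq_zero.1 this
    refine Set.infinite_of_injective_forall_mem (f := fun k : ℕ => (((1/2 : ℝ)^k : ℝ) : ℂ)) ?_ hmem
    intro m n h
    have h' : (1/2 : ℝ)^m = (1/2)^n := Complex.ofReal_injective h
    exact pow_right_injective₀ (by norm_num) (by norm_num) h'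

theorem hh_scale (b : A) (hb : 0 ≤ b) (hi : (spectrum ℂ b).Infinite) :
    ∃ r : ℝ, 0 ≤ r • b ∧ r • b ≤ 1 ∧ (spectrum ℂ (r • b)).Infinite := by
  have hpos : 0 < ‖b‖ + 1 := by positivity
  refine ⟨(‖b‖+1)⁻¹, smul_nonneg (by positivity) hb, ?_, ?_⟩
  · rw [← CStarAlgebra.norm_le_one_iff_of_nonneg _ (smul_nonneg (by positivity) hb), norm_smul,
      norm_inv, Real.norm_of_nonneg hpos.le, inv_mul_le_iff₀ hpos]
    linarith
  · have hne : (((‖b‖+1)⁻¹ : ℝ) : ℂ) ≠ 0 := by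
      exact_mod_cast (inv_pos.2 hpos).ne'
    have := spectrum.unit_smul_eq_smul b (Units.mk0 _ hne)
    have h2 : (Units.mk0 _ hne) • b = (‖b‖+1)⁻¹ • b := by
      rw [Units.smul_def, Units.val_mk0]; exact Complex.coe_smul _ _
    rw [h2] at this
    rw [this]
    exact hi.smul_set

theorem hh_main (hsimple : ∀ I : TwoSidedIdeal A, IsClosed (I : Set A) → I = ⊥ ∨ I = ⊤)
    (hinfdim : ¬ FiniteDimensional ℂ A) (a : A) (ha : 0 ≤ a) (ha0 : a ≠ 0) :
    ∃ b, (∃ y, b = a * y * a) ∧ 0 ≤ b ∧ b ≤ 1 ∧ (spectrum ℂ b).Infinite := by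
  suffices h : ∃ b, (∃ y, b = a * y * a) ∧ 0 ≤ b ∧ (spectrum ℂ b).Infinite by
    obtain ⟨b, ⟨y, hy⟩, h0, hi⟩ := h
    obtain ⟨r, h1, h2, h3⟩ := hh_scale b h0 hi
    exact ⟨r • b, ⟨r • y, by rw [hy]; simp⟩, h1, h2, h3⟩
  by_contra hcon
  have hfin : ∀ y, 0 ≤ a * y * a → (spectrum ℂ (a * y * a)).Finite := by
    intro y hy
    by_contra hi
    exact hcon ⟨_, ⟨y, rfl⟩, hy, hi⟩
  have hsa : star a = a := (IsSelfAdjoint.of_nonneg ha).star_eq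
  have hz : 0 ≤ a * 1 * a := by
    have := star_mul_self_nonneg a
    rw [hsa] at this
    rwa [mul_one]
  have hz0 : a * 1 * a ≠ 0 := by
    intro h
    apply ha0
    rw [mul_one] at h
    apply CStarRing.star_mul_self_eq_zero_iff a |>.1
    rw [hsa, h]
  obtain ⟨l, p, hl, hp, hp0, h1, h2⟩ := hh_proj _ hz hz0 (hfin _ hz)
  -- p = a * w * a
  have hpw : ∃ w, p = a * w * a := by
    refine ⟨(l⁻¹ * l⁻¹) • (a * p * a), ?_⟩
    have e : (a * 1 * a) * p * (a * 1 * a) = (l * l) • p := by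
      rw [h1, smul_mul_assoc, h2, smul_smul]
    have e2 : a * (a * p * a) * a = (l * l) • p := by
      rw [← e]; simp only [mul_one, mul_assoc]
    rw [mul_smul_comm, smul_mul_assoc, e2, smul_smul]
    field_simp
    simp
  obtain ⟨w, hw⟩ := hpw
  have hfin' : ∀ b, 0 ≤ b → p * b = b → (spectrum ℂ b).Finite := by
    intro b hb hpb
    have hbp : b * p = b := by
      have := congrArg star hpb
      rwa [star_mul, hp.isSelfAdjoint.star_eq, (IsSelfAdjoint.of_nonneg hb).star_eq] at this
    have : b = a * (w * a * b * a * w) * a := by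
      calc b = p * b * p := by rw [hpb, hbp]
        _ = _ := by
          conv_lhs => rw [hw]
          simp only [mul_assoc]
    rw [this] at hb ⊢
    exact hfin _ hb
  let P := {e : A // IsStarProjection e ∧ e ≠ 0 ∧ p * e = e}
  have step : ∀ e : P, ∃ e' : P, e'.1 * e.1 = e'.1 ∧ e'.1 ≠ e.1 := by
    rintro ⟨q, hq, hq0, hpq⟩
    by_contra hno
    push Not at hno
    apply hinfdim
    apply hh_findim hsimple q hq0
    apply hh_scalar q hq
    intro z hz hqz hzq
    by_cases hz0 : z = 0
    · exact ⟨0, by simp [hz0]⟩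
    obtain ⟨m, e, hm, he, he0, h1, h2⟩ := hh_proj z hz hz0
      (hfin' z hz (by rw [← hqz, ← mul_assoc, hpq]))
    have hez : e = m⁻¹ • (z * e) := by rw [h1, smul_smul, inv_mul_cancel₀ hm, one_smul]
    have hze : e = m⁻¹ • (e * z) := by rw [h2, smul_smul, inv_mul_cancel₀ hm, one_smul]
    have hqe : q * e = e := by
      rw [hez, mul_smul_comm, ← mul_assoc, hqz]
    have heq : e * q = e := by
      rw [hze, smul_mul_assoc, mul_assoc, hzq]
    have := hno ⟨e, he, he0, by rw [← hqe, ← mul_assoc, hpq]⟩ heq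
    simp only at this
    subst this
    exact ⟨(m : ℂ), by rw [← hzq, h1]; simp⟩
  choose N hN1 hN2 using step
  let Q : ℕ → P := fun n => Nat.rec ⟨p, hp, hp0, hp.isIdempotentElem⟩ (fun _ e => N e) n
  obtain ⟨b, hb0, hpb, hbi⟩ := hh_chain p (fun n => (Q n).1) (fun n => (Q n).2.1)
    (fun n => (Q n).2.2.2) (fun n => hN1 (Q n)) (fun n => hN2 (Q n))
  exact hbi (hfin' b hb0 hpb)

theorem hh_orth (b : A) (hb : 0 ≤ b) (hi : (spectrum ℂ b).Infinite) (n : ℕ) :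
    ∃ c : Fin n → A, (∀ i, (∃ y, c i = b * y * b) ∧ 0 ≤ c i ∧ c i ≠ 0) ∧
      ∀ i j, i ≠ j → c i * c j = 0 := by
  have hsa : IsSelfAdjoint b := .of_nonneg hb
  have hir : (spectrum ℝ b).Infinite := by
    intro hf
    apply hi
    rw [← hsa.spectrumRestricts.algebraMap_image]
    exact hf.image _
  have hir' : (spectrum ℝ b \ {0}).Infinite := hir.sdiff (Set.finite_singleton 0)
  let E := Set.Infinite.natEmbedding _ hir'
  let t : Fin (n+1) → ℝ := fun i => (E i).1
  have ht : Function.Injective t := by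
    intro i j h
    exact Fin.ext (E.injective (Subtype.ext h))
  let S : Fin (n+1) → Set ℝ := fun i => t '' {j | j ≠ i}
  let g : Fin (n+1) → ℝ → ℝ := fun i x => max 0 (Metric.infDist x (S i) - dist x (t i))
  have hgc : ∀ i, Continuous (g i) := fun i =>
    continuous_const.max ((Metric.continuous_infDist_pt _).sub (continuous_id.dist continuous_const))
  have hg0 : ∀ i x, 0 ≤ g i x := fun i x => le_max_left _ _
  have hgo : ∀ i j, i ≠ j → ∀ x, g i x * g j x = 0 := by
    intro i j hij x
    have h1 : Metric.infDist x (S i) ≤ dist x (t j) :=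
      Metric.infDist_le_dist_of_mem ⟨j, hij.symm, rfl⟩
    have h2 : Metric.infDist x (S j) ≤ dist x (t i) :=
      Metric.infDist_le_dist_of_mem ⟨i, hij, rfl⟩
    rcases le_total (dist x (t i)) (dist x (t j)) with h | h
    · have : g j x = 0 := max_eq_left (by linarith)
      rw [this, mul_zero]
    · have : g i x = 0 := max_eq_left (by linarith)
      rw [this, zero_mul]
  have hgp : ∀ i : Fin n, 0 < g i.castSucc (t i.castSucc) := by
    intro i
    apply lt_max_of_lt_right
    rw [dist_self, sub_zero]
    have hc : IsClosed (S i.castSucc) := (Set.toFinite _).isClosed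
    refine (hc.notMem_iff_infDist_pos ⟨t (Fin.last n), Fin.last n, (Fin.castSucc_lt_last i).ne', rfl⟩).1 ?_
    rintro ⟨j, hj, h⟩
    exact hj (ht h)
  have hform : ∀ i, b * cfc (g i) b * b = cfc (fun x => x * g i x * x) b := by
    intro i
    have h1 : ContinuousOn (g i) (spectrum ℝ b) := (hgc i).continuousOn
    rw [cfc_mul (fun x => x * g i x) (fun x => x) b (by fun_prop) (by fun_prop),
      cfc_mul (fun x => x) (g i) b (by fun_prop) h1, cfc_id' ℝ b]
  have hhc : ∀ i, Continuous (fun x => x * g i x * x) := fun i => by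
    have := hgc i
    fun_prop
  refine ⟨fun i => b * cfc (g i.castSucc) b * b, fun i => ⟨⟨_, rfl⟩, ?_, ?_⟩, ?_⟩
  · exact hsa.conjugate_nonneg (cfc_nonneg fun x _ => hg0 _ x)
  · intro h
    replace h : b * cfc (g i.castSucc) b * b = 0 := h
    rw [hform] at h
    have hm : t i.castSucc ∈ spectrum ℝ b := (E i.castSucc).2.1
    have hm0 : t i.castSucc ≠ 0 := (E i.castSucc).2.2
    have := norm_apply_le_norm_cfc _ b hm (hhc i.castSucc).continuousOn hsa
    rw [h, norm_zero] at this
    have h3 := norm_le_zero_iff.1 this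
    have := (hgp i).ne'
    simp_all
  · intro i j hij
    simp only [hform]
    rw [← cfc_mul _ _ b (hhc _).continuousOn (hhc _).continuousOn, ← cfc_const_zero ℝ b]
    congr 1; ext x
    have := hgo i.castSucc j.castSucc (fun h => hij (Fin.castSucc_injective n h)) x
    linear_combination (x^4) * this

theorem hh_hered (a b y : A) (hb : b ∈ hereditary a) : b * y * b ∈ hereditary a := by
  refine map_mem_closure (f := fun b => b * y * b) (by fun_prop) hb ?_
  rintro _ ⟨z, rfl⟩
  exact ⟨z * a * y * a * z, by simp only [mul_assoc]⟩

end helpers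

/-- Let `A` be a unital infinite-dimensional simple C*-algebra and `a` a nonzero positive
element.  Then the hereditary subalgebra generated by `a` contains a positive element `b`
with `0 ≤ b ≤ 1` whose spectrum is infinite; consequently, for every `n ≥ 1` there exist
`n` nonzero mutually orthogonal positive elements `b_1, ..., b_n` in the hereditary
subalgebra generated by `a`. -/
theorem stmt_2 {A : Type*} [NormedRing A] [StarRing A] [CStarRing A] [NormedAlgebra ℂ A]
    [StarModule ℂ A] [CompleteSpace A] [PartialOrder A] [StarOrderedRing A]
    (hsimple : ∀ I : TwoSidedIdeal A, IsClosed (I : Set A) → I = ⊥ ∨ I = ⊤)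
    (hinfdim : ¬ FiniteDimensional ℂ A)
    (a : A) (ha : 0 ≤ a) (ha0 : a ≠ 0) :
    (∃ b ∈ hereditary a, 0 ≤ b ∧ b ≤ 1 ∧ (spectrum ℂ b).Infinite) ∧
      ∀ n : ℕ, 1 ≤ n → ∃ b : Fin n → A,
        (∀ i, b i ∈ hereditary a ∧ 0 ≤ b i ∧ b i ≠ 0) ∧
        (∀ i j, i ≠ j → b i * b j = 0) := by
  letI : CStarAlgebra A := {}
  obtain ⟨b, hy, h0, h1, hi⟩ := hh_main hsimple hinfdim a ha ha0
  have hb : b ∈ hereditary a := subset_closure hy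
  refine ⟨⟨b, hb, h0, h1, hi⟩, fun n _ => ?_⟩
  obtain ⟨c, hc, hco⟩ := hh_orth b h0 hi n
  refine ⟨c, fun i => ⟨?_, (hc i).2⟩, hco⟩
  obtain ⟨⟨y, hy⟩, _⟩ := hc i
  rw [hy]
  exact hh_hered a b y hb
end

section
/- Let A and B be unital C*-algebras and τ an extremal tracial state on a C*-tensor product A ⊗ B. Then the restriction of τ to A ⊗ 1 is an extremal tracial state of A, and the restriction of τ to 1 ⊗ B is an extremal tracial state of B. -/
open scoped ComplexOrder

/-- A tracial state on a unital C*-algebra: a positive normalized linear functional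
with the trace property. -/
def IsTracialState {A : Type*} [NormedRing A] [StarRing A] [NormedAlgebra ℂ A]
    (τ : A →ₗ[ℂ] ℂ) : Prop :=
  τ 1 = 1 ∧ (∀ a : A, 0 ≤ τ (star a * a)) ∧ ∀ a b : A, τ (a * b) = τ (b * a)

/-- A tracial state is extremal if it is an extreme point of the tracial state space. -/
def IsExtremeTracialState {A : Type*} [NormedRing A] [StarRing A] [NormedAlgebra ℂ A]
    (τ : A →ₗ[ℂ] ℂ) : Prop :=
  IsTracialState τ ∧ ∀ τ₁ τ₂ : A →ₗ[ℂ] ℂ, IsTracialState τ₁ → IsTracialState τ₂ →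
    ∀ c : ℝ, 0 < c → c < 1 →
      (∀ x : A, τ x = (c : ℂ) * τ₁ x + ((1 : ℂ) - c) * τ₂ x) → τ₁ = τ₂

namespace TrAux

variable {A : Type*} [CStarAlgebra A]

/-- two-norm -/
noncomputable def N (f : A →ₗ[ℂ] ℂ) (a : A) : ℝ := Real.sqrt (f (star a * a)).re

/-- positivity -/
def Pos (f : A →ₗ[ℂ] ℂ) : Prop := ∀ a : A, 0 ≤ f (star a * a)

lemma Pos.re {f : A →ₗ[ℂ] ℂ} (hf : Pos f) (a : A) : 0 ≤ (f (star a * a)).re :=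
  (Complex.le_def.1 (hf a)).1

lemma Pos.im {f : A →ₗ[ℂ] ℂ} (hf : Pos f) (a : A) : (f (star a * a)).im = 0 :=
  (Complex.le_def.1 (hf a)).2.symm

lemma N_nonneg (f : A →ₗ[ℂ] ℂ) (a : A) : 0 ≤ N f a := Real.sqrt_nonneg _

lemma N_sq {f : A →ₗ[ℂ] ℂ} (hf : Pos f) (a : A) : N f a ^ 2 = (f (star a * a)).re :=
  Real.sq_sqrt (hf.re a)

lemma Pos.star_eq {f : A →ₗ[ℂ] ℂ} (hf : Pos f) (x : A) :
    f (star x) = star (f x) := by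
  have h1 := hf.im (1 + x)
  have h2 := hf.im (1 + Complex.I • x)
  have h3 := hf.im x
  have h0 := hf.im 1
  simp [mul_add, add_mul, smul_smul] at h1 h2 h3 h0
  rw [h3, h0] at h1 h2
  apply Complex.ext
  · simp; linarith
  · simp; linarith

lemma Pos.star_mul {f : A →ₗ[ℂ] ℂ} (hf : Pos f) (x y : A) :
    f (star y * x) = star (f (star x * y)) := by
  rw [← hf.star_eq]; simp

lemma quad {P R D : ℝ} (h : ∀ t : ℝ, 0 ≤ P * (t * t) + (2 * R) * t + D) : R ^ 2 ≤ P * D := by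
  have := discrim_le_zero h
  unfold discrim at this
  nlinarith

lemma phase (σ g : A →ₗ[ℂ] ℂ) (hσ : Pos σ) {δ : ℝ} (hδ : 0 ≤ δ)
    (h : ∀ a, (g a).re ^ 2 ≤ (σ (star a * a)).re * δ ^ 2) (a : A) :
    ‖g a‖ ≤ δ * N σ a := by
  have h1 := h (star (g a) • a)
  have e1 : (g (star (g a) • a)).re = ‖g a‖ ^ 2 := by
    rw [map_smul, smul_eq_mul, Complex.star_def, ← Complex.normSq_eq_conj_mul_self,
      Complex.normSq_eq_norm_sq]; exact Complex.ofReal_re _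
  have e2 : (σ (star (star (g a) • a) * (star (g a) • a))).re
      = ‖g a‖ ^ 2 * (σ (star a * a)).re := by
    rw [star_smul, star_star, smul_mul_smul_comm, map_smul, smul_eq_mul, Complex.star_def,
      Complex.mul_conj, Complex.normSq_eq_norm_sq, Complex.re_ofReal_mul]
  rw [e1, e2, ← N_sq hσ] at h1
  by_cases h0 : ‖g a‖ = 0
  · rw [h0]; exact mul_nonneg hδ (N_nonneg _ _)
  have hp : 0 < ‖g a‖ := lt_of_le_of_ne (norm_nonneg _) (Ne.symm h0)
  have h2 : ‖g a‖ ^ 2 * (‖g a‖ ^ 2) ≤ ‖g a‖ ^ 2 * (δ * N σ a) ^ 2 := by nlinarith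
  have h3 := le_of_mul_le_mul_left h2 (by positivity)
  exact le_of_sq_le_sq h3 (mul_nonneg hδ (N_nonneg _ _))

lemma cs {f : A →ₗ[ℂ] ℂ} (hf : Pos f) (x y : A) :
    ‖f (star x * y)‖ ≤ N f x * N f y := by
  refine phase f (f ∘ₗ LinearMap.mulLeft ℂ (star x)) hf (N_nonneg f x) ?_ y
  intro y
  rw [N_sq hf]
  refine quad fun t => ?_
  have h := hf.re (x + (t : ℂ) • y)
  have h2 := congrArg Complex.re (hf.star_mul x y)
  simp [mul_add, add_mul, smul_smul] at h h2 ⊢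
  rw [h2] at h
  linarith

lemma exists_bound (a : A) : ∃ y : A, ((‖a‖ ^ 2 : ℝ) : ℂ) • (1 : A) - star a * a = star y * y := by
  let := CStarAlgebra.spectralOrder A
  have := CStarAlgebra.spectralOrderedRing A
  have h := CStarAlgebra.star_mul_le_algebraMap_norm_sq (a := a)
  rw [← sub_nonneg, CStarAlgebra.nonneg_iff_eq_star_mul_self] at h
  obtain ⟨y, hy⟩ := h
  refine ⟨y, ?_⟩
  rw [← hy, Algebra.algebraMap_eq_smul_one, Complex.coe_smul]

lemma N_mul_le {f : A →ₗ[ℂ] ℂ} (hf : Pos f) (a x : A) : N f (a * x) ≤ ‖a‖ * N f x := by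
  obtain ⟨y, hy⟩ := exists_bound a
  have h := hf.re (y * x)
  have e : star (y * x) * (y * x) = ((‖a‖ ^ 2 : ℝ) : ℂ) • (star x * x)
      - star (a * x) * (a * x) := by
    have : star (y * x) * (y * x) = star x * (star y * y) * x := by
      simp [mul_assoc]
    rw [this, ← hy]; simp [mul_sub, sub_mul, mul_assoc]
  rw [e, map_sub, map_smul, smul_eq_mul, Complex.sub_re, Complex.re_ofReal_mul, ← N_sq hf,
    ← N_sq hf] at h
  refine le_of_sq_le_sq (by nlinarith) (mul_nonneg (norm_nonneg _) (N_nonneg _ _))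

lemma N_star {f : A →ₗ[ℂ] ℂ} (ht : ∀ a b, f (a * b) = f (b * a)) (x : A) :
    N f (star x) = N f x := by
  unfold N; rw [star_star, ht]

lemma norm_le {f : A →ₗ[ℂ] ℂ} (hf : Pos f) (x : A) : ‖f x‖ ≤ (N f 1 * N f 1) * ‖x‖ := by
  have h := cs hf 1 x
  have h2 := N_mul_le hf x 1
  rw [mul_one] at h2
  simp only [star_one, one_mul] at h
  have := mul_le_mul_of_nonneg_left h2 (N_nonneg f 1)
  linarith

lemma posf_cont {f : A →ₗ[ℂ] ℂ} (hf : Pos f) : Continuous f :=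
  (f.mkContinuous _ (norm_le hf)).continuous

lemma N_add_le {f : A →ₗ[ℂ] ℂ} (hf : Pos f) (x y : A) : N f (x + y) ≤ N f x + N f y := by
  have h := cs hf x y
  have h1 := Complex.re_le_norm (f (star x * y))
  have h2 := congrArg Complex.re (hf.star_mul x y)
  have hx := N_sq hf x
  have hy := N_sq hf y
  have hxy := N_sq hf (x + y)
  simp [mul_add, add_mul] at hxy h2
  refine le_of_sq_le_sq ?_ (add_nonneg (N_nonneg _ _) (N_nonneg _ _))
  nlinarith

lemma N_neg (f : A →ₗ[ℂ] ℂ) (x : A) : N f (-x) = N f x := by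
  unfold N; simp

lemma decomp (h : A) (hh : IsSelfAdjoint h) :
    ∃ p q : A, IsSelfAdjoint p ∧ IsSelfAdjoint q ∧ h = p * p - q * q ∧ p * q = 0 := by
  refine ⟨cfc (fun x : ℝ => Real.sqrt x) h, cfc (fun x : ℝ => Real.sqrt (-x)) h,
    cfc_predicate _ _, cfc_predicate _ _, ?_, ?_⟩
  · rw [← cfc_mul .., ← cfc_mul .., ← cfc_sub ..]
    conv_lhs => rw [← cfc_id ℝ h]
    apply cfc_congr
    intro x _
    rcases le_total 0 x with hx | hx
    · simp [Real.mul_self_sqrt hx, Real.sqrt_eq_zero_of_nonpos (neg_nonpos.2 hx)]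
    · simp [Real.mul_self_sqrt (neg_nonneg.2 hx), Real.sqrt_eq_zero_of_nonpos hx]
  · rw [← cfc_mul .., ← cfc_zero ℝ h]
    apply cfc_congr
    intro x _
    rcases le_total 0 x with hx | hx
    · simp [Real.sqrt_eq_zero_of_nonpos (neg_nonpos.2 hx)]
    · simp [Real.sqrt_eq_zero_of_nonpos hx]

/-- functional to be minimised -/
noncomputable def F (σ ψ : A →ₗ[ℂ] ℂ) (a : A) : ℝ := (σ (star a * a)).re - 2 * (ψ a).re

lemma F_lower {σ ψ : A →ₗ[ℂ] ℂ} (hσ : Pos σ) (hψ : Pos ψ)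
    (hle : ∀ a, (ψ (star a * a)).re ≤ (σ (star a * a)).re) (a : A) :
    - (N ψ 1) ^ 2 ≤ F σ ψ a := by
  have h := cs hψ 1 a
  have h1 := Complex.re_le_norm (ψ a)
  simp only [star_one, one_mul] at h
  have h2 := hle a
  rw [← N_sq hψ, ← N_sq hσ] at h2
  unfold F
  rw [← N_sq hσ]
  nlinarith [sq_nonneg (N ψ 1 - N ψ a)]

lemma F_improve {σ ψ : A →ₗ[ℂ] ℂ} (hσ : Pos σ) (hψ : Pos ψ)
    (ht : ∀ a b, σ (a * b) = σ (b * a)) (a : A) :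
    ∃ p : A, IsSelfAdjoint p ∧ F σ ψ (p * p) ≤ F σ ψ a := by
  obtain ⟨p, q, hp, hq, e, hpq⟩ := decomp ((1 / 2 : ℂ) • (a + star a)) (by
    rw [IsSelfAdjoint, star_smul]; simp [add_comm])
  have hp' := hp.star_eq
  have hq' := hq.star_eq
  have hqp : q * p = 0 := by
    have := congrArg star hpq
    simpa [hp', hq'] using this
  refine ⟨p, hp, ?_⟩
  -- imaginary part
  have hk := hσ.re ((1 / 2 : ℂ) • (a - star a))
  have hqq := hσ.re (q * q)
  have hψq := hψ.re q
  have e1 : (σ (star ((1 / 2 : ℂ) • (a + star a)) * ((1 / 2 : ℂ) • (a + star a)))).re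
     = (σ (star (p * p) * (p * p))).re + (σ (star (q * q) * (q * q))).re := by
    rw [e]
    have : star (p * p - q * q) * (p * p - q * q)
      = star (p * p) * (p * p) + star (q * q) * (q * q) := by
      simp only [star_sub, star_mul, hp', hq']
      have z1 : p * p * (q * q) = 0 := by
        rw [mul_assoc, ← mul_assoc p q q, hpq]; simp
      have z2 : q * q * (p * p) = 0 := by
        rw [mul_assoc, ← mul_assoc q p p, hqp]; simp
      simp only [sub_mul, mul_sub, z1, z2]; abel
    rw [this, map_add, Complex.add_re]
  have e2 : (ψ a).re = (ψ (p * p)).re - (ψ (q * q)).re := by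
    rw [← Complex.sub_re, ← map_sub, ← e]
    simp [hψ.star_eq]
    ring
  have e3 : (σ (star a * a)).re = (σ (star ((1 / 2 : ℂ) • (a + star a)) * ((1 / 2 : ℂ) • (a + star a)))).re
     + (σ (star ((1 / 2 : ℂ) • (a - star a)) * ((1 / 2 : ℂ) • (a - star a)))).re := by
    have := ht a (star a)
    simp [mul_add, add_mul, mul_sub, sub_mul, smul_smul, this]
    ring
  rw [hq'] at hψq
  unfold F
  linarith

lemma exists_approx {σ ψ : A →ₗ[ℂ] ℂ} (hσ : Pos σ) (hψ : Pos ψ)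
    (ht : ∀ a b, σ (a * b) = σ (b * a))
    (hle : ∀ a, (ψ (star a * a)).re ≤ (σ (star a * a)).re) {δ : ℝ} (hδ : 0 < δ) :
    ∃ p : A, IsSelfAdjoint p ∧ ∀ a, ‖σ ((p * p) * a) - ψ a‖ ≤ δ * N σ a := by
  have hb : BddBelow (Set.range (F σ ψ)) :=
    ⟨_, by rintro _ ⟨a, rfl⟩; exact F_lower hσ hψ hle a⟩
  obtain ⟨_, ⟨a, rfl⟩, ha⟩ := exists_lt_of_csInf_lt (Set.range_nonempty (F σ ψ))
    (lt_add_of_pos_right (sInf (Set.range (F σ ψ))) (pow_pos hδ 2))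
  obtain ⟨p, hp, hpa⟩ := F_improve hσ hψ ht a
  refine ⟨p, hp, fun x => ?_⟩
  refine phase σ (σ ∘ₗ LinearMap.mulLeft ℂ (p * p) - ψ) hσ hδ.le (fun x => ?_) x
  refine quad fun t => ?_
  have hm := csInf_le hb ⟨p * p + (t : ℂ) • x, rfl⟩
  have h3 : F σ ψ (p * p) ≤ F σ ψ (p * p + (t : ℂ) • x) + δ ^ 2 := by linarith
  have h2 := congrArg Complex.re (hσ.star_mul (p * p) x)
  have hp' := hp.star_eq
  unfold F at h3
  simp [mul_add, add_mul, smul_smul, hp', mul_assoc] at h2 h3 ⊢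
  rw [h2] at h3
  linarith

lemma N_of_le {σ : A →ₗ[ℂ] ℂ} (hσ : Pos σ) {e : A} (he : IsSelfAdjoint e) {δ : ℝ} (hδ : 0 ≤ δ)
    (h : ∀ a, ‖σ (e * a)‖ ≤ δ * N σ a) : N σ e ≤ δ := by
  have h1 := h e
  have h2 := Complex.re_le_norm (σ (e * e))
  have h3 := N_sq hσ e
  rw [he.star_eq] at h3
  by_contra hc
  push Not at hc
  nlinarith

lemma N_comm {σ ψ : A →ₗ[ℂ] ℂ} (hσ : Pos σ)
    (ht : ∀ a b, σ (a * b) = σ (b * a)) (htψ : ∀ a b, ψ (a * b) = ψ (b * a))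
    {h : A} (hh : IsSelfAdjoint h) {δ : ℝ} (hδ : 0 ≤ δ)
    (H : ∀ a, ‖σ (h * a) - ψ a‖ ≤ δ * N σ a) (a : A) :
    N σ (a * h - h * a) ≤ 2 * ‖a‖ * δ := by
  obtain ⟨d, hd⟩ : ∃ d, d = a * h - h * a := ⟨_, rfl⟩
  rw [← hd]
  have h1 := H (star a * d - d * star a)
  have e1 : ψ (star a * d - d * star a) = 0 := by rw [map_sub, htψ, sub_self]
  have e2 : σ (h * (star a * d - d * star a)) = σ (star d * d) := by
    have : star d = h * star a - star a * h := by simp [hd, hh.star_eq]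
    rw [this, mul_sub, sub_mul, map_sub, map_sub, mul_assoc, ← mul_assoc h d, ht (h * d),
      mul_assoc (star a)]
  have h2 : N σ (star a * d - d * star a) ≤ 2 * ‖a‖ * N σ d := by
    have b1 := N_mul_le hσ (star a) d
    have b2 : N σ (-(d * star a)) ≤ ‖a‖ * N σ d := by
      rw [N_neg, ← N_star ht, star_mul, star_star, ← N_star ht d]
      exact N_mul_le hσ _ _
    rw [norm_star] at b1
    rw [sub_eq_add_neg]
    linarith [N_add_le hσ (star a * d) (-(d * star a))]
  rw [e1, e2, sub_zero] at h1
  have h3 := Complex.re_le_norm (σ (star d * d))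
  rw [← N_sq hσ] at h3
  have h4 := mul_le_mul_of_nonneg_left h2 hδ
  by_contra hc
  push Not at hc
  have : 0 < N σ d := lt_of_le_of_lt (by positivity) hc
  nlinarith

variable {B C : Type*} [CStarAlgebra B] [CStarAlgebra C]

open Filter Topology

lemma extend (ιA : A →⋆ₐ[ℂ] C) (ιB : B →⋆ₐ[ℂ] C)
    (hcomm : ∀ (a : A) (b : B), ιA a * ιB b = ιB b * ιA a)
    (hdense : Dense (↑(Submodule.span ℂ {x : C | ∃ (a : A) (b : B), x = ιA a * ιB b}) : Set C))
    {τ : C →ₗ[ℂ] ℂ} (hτ : Pos τ) (ht : ∀ a b, τ (a * b) = τ (b * a))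
    {σ : A →ₗ[ℂ] ℂ} (hστ : ∀ a, σ a = τ (ιA a))
    {ψ : A →ₗ[ℂ] ℂ} (hψ : Pos ψ) (htψ : ∀ a b, ψ (a * b) = ψ (b * a))
    (hle : ∀ a, (ψ (star a * a)).re ≤ (σ (star a * a)).re) :
    ∃ φ : C →ₗ[ℂ] ℂ, Pos φ ∧ (∀ a b, φ (a * b) = φ (b * a)) ∧ (∀ a, φ (ιA a) = ψ a) ∧
      ∃ h : ℕ → A, (∀ n, IsSelfAdjoint (h n)) ∧
        (∀ n a, ‖σ (h n * a) - ψ a‖ ≤ (1 / ((n : ℝ) + 1)) * N σ a) ∧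
        ∀ x, Tendsto (fun n => τ (ιA (h n) * x)) atTop (𝓝 (φ x)) := by
  have hσ : Pos σ := fun a => by rw [hστ, map_mul ιA, map_star ιA]; exact hτ _
  have htσ : ∀ a b, σ (a * b) = σ (b * a) := fun a b => by
    rw [hστ, hστ, map_mul ιA, map_mul ιA, ht]
  have hN : ∀ a, N τ (ιA a) = N σ a := fun a => by
    unfold N; rw [hστ, map_mul ιA, map_star ιA]
  have hpos : ∀ n : ℕ, 0 < 1 / ((n : ℝ) + 1) := fun n => Nat.one_div_pos_of_nat
  have hlim := tendsto_one_div_add_atTop_nhds_zero_nat (𝕜 := ℝ)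
  choose p hp hpa using fun n : ℕ => exists_approx hσ hψ htσ hle (hpos n)
  have hh : ∀ n, IsSelfAdjoint (p n * p n) := fun n => by
    rw [IsSelfAdjoint, star_mul, (hp n).star_eq]
  have hdiff : ∀ n m, N σ (p n * p n - p m * p m) ≤ 1 / ((n : ℝ) + 1) + 1 / ((m : ℝ) + 1) := by
    intro n m
    refine N_of_le hσ ((hh n).sub (hh m)) (add_pos (hpos n) (hpos m)).le fun a => ?_
    have e : σ ((p n * p n - p m * p m) * a)
      = (σ (p n * p n * a) - ψ a) - (σ (p m * p m * a) - ψ a) := by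
      rw [sub_mul, map_sub]; ring
    rw [e, add_mul]
    exact (norm_sub_le _ _).trans (add_le_add (hpa n a) (hpa m a))
  have hex : ∀ x : C, ∃ l, Tendsto (fun n => τ (ιA (p n * p n) * x)) atTop (𝓝 l) := by
    intro x
    apply cauchySeq_tendsto_of_complete
    refine cauchySeq_of_le_tendsto_0 (fun n : ℕ => (2 * (1 / ((n : ℝ) + 1))) * N τ x) ?_ ?_
    · intro n m k hn hm
      rw [dist_eq_norm, ← map_sub, ← sub_mul, ← map_sub]
      have h1 := cs hτ (ιA (p n * p n - p m * p m)) x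
      rw [← map_star, ((hh n).sub (hh m)).star_eq, hN] at h1
      refine h1.trans (mul_le_mul_of_nonneg_right ?_ (N_nonneg _ _))
      refine (hdiff n m).trans ?_
      have a1 := Nat.one_div_le_one_div (α := ℝ) hn
      have a2 := Nat.one_div_le_one_div (α := ℝ) hm
      linarith
    · simpa using (hlim.const_mul 2).mul_const (N τ x)
  choose φ0 hφ0 using hex
  let φ : C →ₗ[ℂ] ℂ :=
    { toFun := φ0
      map_add' := fun x y => tendsto_nhds_unique (hφ0 (x + y)) (by
        simpa only [mul_add, map_add] using (hφ0 x).add (hφ0 y))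
      map_smul' := fun c x => tendsto_nhds_unique (hφ0 (c • x)) (by
        simpa only [mul_smul_comm, map_smul, RingHom.id_apply] using (hφ0 x).const_smul c) }
  have hφ : ∀ x, Tendsto (fun n => τ (ιA (p n * p n) * x)) atTop (𝓝 (φ x)) := hφ0
  have hφpos : Pos φ := by
    intro x
    refine ge_of_tendsto' (hφ (star x * x)) fun n => ?_
    have e : τ (ιA (p n * p n) * (star x * x))
      = τ (star (ιA (p n) * star x) * (ιA (p n) * star x)) := by
      rw [star_mul, star_star, ← map_star, (hp n).star_eq, map_mul ιA, ← mul_assoc, ht]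
      simp only [mul_assoc]
    rw [e]; exact hτ _
  refine ⟨φ, hφpos, ?_, ?_, fun n => p n * p n, hh, hpa, hφ⟩
  · intro x y
    have key : ∀ a b, φ (ιA a * ιB b * y) = φ (y * (ιA a * ιB b)) := by
      intro a b
      rw [← sub_eq_zero, ← map_sub]
      refine tendsto_nhds_unique (hφ _) ?_
      have hz : Tendsto (fun n : ℕ => (2 * ‖a‖ * (1 / ((n : ℝ) + 1))) * N τ (ιB b * y))
          atTop (𝓝 0) := by
        simpa using (hlim.const_mul (2 * ‖a‖)).mul_const (N τ (ιB b * y))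
      refine squeeze_zero_norm (fun n => ?_) hz
      obtain ⟨h, hhdef⟩ : ∃ h, h = p n * p n := ⟨_, rfl⟩
      rw [← hhdef]
      have e : τ (ιA h * (ιA a * ιB b * y - y * (ιA a * ιB b)))
          = τ (star (ιA (star (h * a - a * h))) * (ιB b * y)) := by
        rw [map_star, star_star, mul_sub, map_sub, map_sub, map_mul ιA, map_mul ιA, sub_mul, map_sub]
        congr 1
        · simp only [mul_assoc]
        · rw [← mul_assoc, ht, mul_assoc (ιA a), ← mul_assoc (ιB b), ← hcomm]
          simp only [mul_assoc]
      rw [e]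
      refine (cs hτ _ _).trans (mul_le_mul_of_nonneg_right ?_ (N_nonneg _ _))
      rw [hN, N_star htσ, ← neg_sub, N_neg]
      rw [hhdef]
      exact N_comm hσ htσ htψ (hh n) (hpos n).le (hpa n) a
    have hc := posf_cont hφpos
    have hcl : IsClosed {x : C | φ (x * y) = φ (y * x)} :=
      isClosed_eq (hc.comp (continuous_id.mul continuous_const))
        (hc.comp (continuous_const.mul continuous_id))
    have hsub : (↑(Submodule.span ℂ {x : C | ∃ (a : A) (b : B), x = ιA a * ιB b}) : Set C)
        ⊆ {x : C | φ (x * y) = φ (y * x)} := by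
      intro x hx
      refine Submodule.span_induction (p := fun x _ => φ (x * y) = φ (y * x)) ?_ ?_ ?_ ?_ hx
      · rintro _ ⟨a, b, rfl⟩; exact key a b
      · simp
      · intro u v _ _ hu hv
        rw [add_mul, mul_add, map_add, map_add, hu, hv]
      · intro c u _ hu
        rw [smul_mul_assoc, mul_smul_comm, map_smul, map_smul, hu]
    exact hcl.closure_subset_iff.2 hsub (hdense x)
  · intro a
    refine tendsto_nhds_unique (hφ (ιA a)) ?_
    rw [tendsto_iff_norm_sub_tendsto_zero]
    refine squeeze_zero (fun _ => norm_nonneg _) (fun n => ?_)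
      (g := fun n : ℕ => (1 / ((n : ℝ) + 1)) * N σ a) (by simpa using hlim.mul_const (N σ a))
    rw [← map_mul ιA, ← hστ]
    exact hpa n a

lemma half (ιA : A →⋆ₐ[ℂ] C) (ιB : B →⋆ₐ[ℂ] C)
    (hcomm : ∀ (a : A) (b : B), ιA a * ιB b = ιB b * ιA a)
    (hdense : Dense (↑(Submodule.span ℂ {x : C | ∃ (a : A) (b : B), x = ιA a * ιB b}) : Set C))
    (τ : C →ₗ[ℂ] ℂ) (hτ : IsExtremeTracialState τ) :
    IsExtremeTracialState (τ ∘ₗ ιA.toAlgHom.toLinearMap) := by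
  obtain ⟨⟨h1, hτp, ht⟩, hext⟩ := hτ
  have hστ : ∀ a, (τ ∘ₗ ιA.toAlgHom.toLinearMap) a = τ (ιA a) := fun a => rfl
  generalize hσd : τ ∘ₗ ιA.toAlgHom.toLinearMap = σ at hστ
  have hσ : Pos σ := fun a => by rw [hστ, map_mul ιA, map_star ιA]; exact hτp _
  refine ⟨⟨by rw [hστ, map_one, h1], hσ, fun a b => by rw [hστ, hστ, map_mul ιA, map_mul ιA, ht]⟩, ?_⟩
  rintro τ₁ τ₂ ⟨h11, hp1, ht1⟩ ⟨h21, hp2, ht2⟩ c hc0 hc1 hsum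
  have hp1 : Pos τ₁ := hp1
  have hp2 : Pos τ₂ := hp2
  have hc0' : (0 : ℂ) ≤ (c : ℂ) := by exact_mod_cast hc0.le
  have hc1' : (0 : ℂ) ≤ ((1 - c : ℝ) : ℂ) := by exact_mod_cast (sub_pos.2 hc1).le
  have hsum' : ∀ a, σ a = ((c : ℂ) • τ₁) a + (((1 - c : ℝ) : ℂ) • τ₂) a := fun a => by
    rw [hsum]; simp
  have q1 : Pos ((c : ℂ) • τ₁) := fun a => mul_nonneg hc0' (hp1 a)
  have q2 : Pos (((1 - c : ℝ) : ℂ) • τ₂) := fun a => mul_nonneg hc1' (hp2 a)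
  obtain ⟨φ₁, P1, T1, E1, g1, s1, b1, l1⟩ := extend ιA ιB hcomm hdense hτp ht hστ q1
    (fun a b => by simp [ht1 a b])
    (fun a => by rw [hsum', Complex.add_re]; linarith [q2.re a])
  obtain ⟨φ₂, P2, T2, E2, g2, s2, b2, l2⟩ := extend ιA ιB hcomm hdense hτp ht hστ q2
    (fun a b => by simp [ht2 a b])
    (fun a => by rw [hsum', Complex.add_re]; linarith [q1.re a])
  have hS : ∀ x, τ x = φ₁ x + φ₂ x := by
    intro x
    have hl := ((l1 x).add (l2 x)).sub_const (τ x)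
    have hlim := tendsto_one_div_add_atTop_nhds_zero_nat (𝕜 := ℝ)
    have hz : Tendsto (fun n : ℕ => (2 * (1 / ((n : ℝ) + 1))) * N τ x) atTop (𝓝 0) := by
      simpa using (hlim.const_mul 2).mul_const (N τ x)
    have h0 := tendsto_nhds_unique hl (squeeze_zero_norm (fun n => ?_) hz)
    · exact (sub_eq_zero.1 h0).symm
    have sa : IsSelfAdjoint (g1 n + g2 n - 1) := ((s1 n).add (s2 n)).sub (.one A)
    have e : τ (ιA (g1 n) * x) + τ (ιA (g2 n) * x) - τ x
        = τ (star (ιA (g1 n + g2 n - 1)) * x) := by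
      rw [← map_star, sa.star_eq, map_sub, map_add, map_one, sub_mul, add_mul, map_sub, map_add,
        one_mul]
    rw [e]
    refine (cs hτp _ _).trans (mul_le_mul_of_nonneg_right ?_ (N_nonneg _ _))
    have hN : N τ (ιA (g1 n + g2 n - 1)) = N σ (g1 n + g2 n - 1) := by
      unfold N; rw [hστ, map_mul ιA, map_star ιA]
    rw [hN]
    refine N_of_le hσ sa (by positivity) fun a => ?_
    have e2 : σ ((g1 n + g2 n - 1) * a) = (σ (g1 n * a) - ((c : ℂ) • τ₁) a)
        + (σ (g2 n * a) - (((1 - c : ℝ) : ℂ) • τ₂) a) := by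
      rw [sub_mul, add_mul, map_sub, map_add, one_mul, hsum' a]; ring
    rw [e2]
    refine (norm_add_le _ _).trans ?_
    have := b1 n a
    have := b2 n a
    linarith
  have hcne : (c : ℂ) ≠ 0 := by exact_mod_cast hc0.ne'
  have hcne' : ((1 - c : ℝ) : ℂ) ≠ 0 := by exact_mod_cast (sub_pos.2 hc1).ne'
  have hi0 : (0 : ℂ) ≤ (c : ℂ)⁻¹ := by
    rw [← Complex.ofReal_inv]; exact_mod_cast (inv_pos.2 hc0).le
  have hi1 : (0 : ℂ) ≤ ((1 - c : ℝ) : ℂ)⁻¹ := by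
    rw [← Complex.ofReal_inv]; exact_mod_cast (inv_pos.2 (sub_pos.2 hc1)).le
  have R1 : ∀ a, ((c : ℂ)⁻¹ • φ₁) (ιA a) = τ₁ a := fun a => by
    rw [LinearMap.smul_apply, E1, LinearMap.smul_apply, smul_smul, inv_mul_cancel₀ hcne, one_smul]
  have R2 : ∀ a, (((1 - c : ℝ) : ℂ)⁻¹ • φ₂) (ιA a) = τ₂ a := fun a => by
    rw [LinearMap.smul_apply, E2, LinearMap.smul_apply, smul_smul, inv_mul_cancel₀ hcne', one_smul]
  have hfin := hext ((c : ℂ)⁻¹ • φ₁) (((1 - c : ℝ) : ℂ)⁻¹ • φ₂)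
    ⟨by rw [← map_one ιA, R1, h11], fun a => mul_nonneg hi0 (P1 a), fun a b => by simp [T1 a b]⟩
    ⟨by rw [← map_one ιA, R2, h21], fun a => mul_nonneg hi1 (P2 a),
      fun a b => by rw [LinearMap.smul_apply, LinearMap.smul_apply, T2]⟩
    c hc0 hc1 (fun x => by
      have : (1 : ℂ) - c = ((1 - c : ℝ) : ℂ) := by push_cast; rfl
      rw [hS, this, LinearMap.smul_apply, LinearMap.smul_apply, smul_eq_mul, smul_eq_mul,
        mul_inv_cancel_left₀ hcne, mul_inv_cancel_left₀ hcne'])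
  ext a
  rw [← R1, ← R2, hfin]

end TrAux

/-- Let `A`, `B` be unital C*-algebras and `τ` an extremal tracial state on a C*-tensor
product `C = A ⊗ B` (realized by commuting unital embeddings `ιA, ιB` with dense joint
span).  Then the restriction of `τ` to `A ⊗ 1` is an extremal tracial state of `A`, and
the restriction of `τ` to `1 ⊗ B` is an extremal tracial state of `B`. -/
theorem stmt_10 {A B C : Type*}
    [NormedRing A] [StarRing A] [CStarRing A] [NormedAlgebra ℂ A] [StarModule ℂ A]
    [CompleteSpace A]
    [NormedRing B] [StarRing B] [CStarRing B] [NormedAlgebra ℂ B] [StarModule ℂ B]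
    [CompleteSpace B]
    [NormedRing C] [StarRing C] [CStarRing C] [NormedAlgebra ℂ C] [StarModule ℂ C]
    [CompleteSpace C]
    (ιA : A →⋆ₐ[ℂ] C) (ιB : B →⋆ₐ[ℂ] C)
    (hcomm : ∀ (a : A) (b : B), ιA a * ιB b = ιB b * ιA a)
    (hdense : Dense (↑(Submodule.span ℂ {x : C | ∃ (a : A) (b : B), x = ιA a * ιB b}) : Set C))
    (τ : C →ₗ[ℂ] ℂ) (hτ : IsExtremeTracialState τ) :
    IsExtremeTracialState (τ ∘ₗ ιA.toAlgHom.toLinearMap) ∧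
    IsExtremeTracialState (τ ∘ₗ ιB.toAlgHom.toLinearMap) := by
  let _ : CStarAlgebra A := {}
  let _ : CStarAlgebra B := {}
  let _ : CStarAlgebra C := {}
  refine ⟨TrAux.half ιA ιB hcomm hdense τ hτ,
    TrAux.half ιB ιA (fun b a => (hcomm a b).symm) ?_ τ hτ⟩
  have e : {x : C | ∃ (a : B) (b : A), x = ιB a * ιA b}
      = {x : C | ∃ (a : A) (b : B), x = ιA a * ιB b} := by
    ext x
    constructor
    · rintro ⟨b, a, rfl⟩; exact ⟨a, b, (hcomm a b).symm⟩
    · rintro ⟨a, b, rfl⟩; exact ⟨b, a, hcomm a b⟩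
  rw [e]
  exact hdense
end

section
/- Let A and B be unital C*-algebras and τ an extremal tracial state on a C*-tensor product A ⊗ B. Then τ is the product of its restrictions: τ(a ⊗ b) = τ(a ⊗ 1)·τ(1 ⊗ b) for all a ∈ A, b ∈ B. -/
open scoped ComplexOrder

section helpers

open Filter Topology

theorem aux_bound {C : Type*} [CStarAlgebra C] (z : C) :
    ∃ w : C, star z * z + star w * w = ((‖z‖ ^ 2 : ℝ) : ℂ) • (1 : C) := by
  letI := CStarAlgebra.spectralOrder C
  haveI := CStarAlgebra.spectralOrderedRing C
  have h := CStarAlgebra.star_mul_le_algebraMap_norm_sq (a := z)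
  rw [← sub_nonneg, CStarAlgebra.nonneg_iff_eq_star_mul_self] at h
  obtain ⟨w, hw⟩ := h
  refine ⟨w, ?_⟩
  rw [← hw, Algebra.algebraMap_eq_smul_one, add_sub_cancel, Complex.coe_smul]

theorem aux_span {B : Type*} [CStarAlgebra B] :
    Submodule.span ℂ {b : B | ∃ r s : B, b = star r * r ∧ 1 - b = star s * s} = ⊤ := by
  letI := CStarAlgebra.spectralOrder B
  haveI := CStarAlgebra.spectralOrderedRing B
  rw [eq_top_iff, ← CStarAlgebra.span_nonneg_inter_unitClosedBall]
  apply Submodule.span_mono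
  rintro b ⟨hb, hb1⟩
  have hb : 0 ≤ b := hb
  have h1 : ‖b‖ ≤ 1 := by simpa using hb1
  rw [CStarAlgebra.norm_le_one_iff_of_nonneg b hb, ← sub_nonneg,
    CStarAlgebra.nonneg_iff_eq_star_mul_self] at h1
  rw [CStarAlgebra.nonneg_iff_eq_star_mul_self] at hb
  obtain ⟨r, hr⟩ := hb
  obtain ⟨s, hs⟩ := h1
  exact ⟨r, s, hr, hs⟩

variable {C : Type*} [NormedRing C] [StarRing C] [NormedAlgebra ℂ C] [StarModule ℂ C]

theorem aux_star {τ : C →ₗ[ℂ] ℂ} (hτ : IsTracialState τ) (x : C) :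
    τ (star x) = star (τ x) := by
  obtain ⟨h1, hp, -⟩ := hτ
  have key : ∀ y : C, (τ y + τ (star y)).im = 0 := by
    intro y
    have e : star (1 + y) * (1 + y) = 1 + y + star y + star y * y := by
      simp only [star_add, star_one]; noncomm_ring
    have := hp (1 + y)
    have h2 := hp y
    rw [e] at this
    simp only [map_add, h1] at this
    rw [Complex.le_def] at this h2
    have a := this.2
    have b := h2.2
    simp at a b ⊢
    linarith
  have k1 := key x
  have k2 := key (Complex.I • x)
  simp [star_smul] at k1 k2
  apply Complex.ext <;> simp <;> linarith

theorem aux_cs {τ : C →ₗ[ℂ] ℂ} (hτ : IsTracialState τ) (x y : C) :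
    ‖τ (star x * y)‖ ^ 2 ≤ (τ (star x * x)).re * (τ (star y * y)).re := by
  let core : PreInnerProductSpace.Core ℂ C :=
    { inner := fun x y => τ (star x * y)
      conj_inner_symm := fun x y => by
        have := aux_star hτ (star y * x)
        simp only [star_mul, star_star] at this
        exact this.symm
      re_inner_nonneg := fun x => (Complex.le_def.1 (hτ.2.1 x)).1
      add_left := fun x y z => by simp [add_mul]
      smul_left := fun x y r => by simp [star_smul] }
  have h := @InnerProductSpace.Core.inner_mul_inner_self_le ℂ C _ _ _ core x y
  have e : τ (star y * x) = star (τ (star x * y)) := by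
    rw [← aux_star hτ]; simp
  change ‖τ (star x * y)‖ * ‖τ (star y * x)‖ ≤ (τ (star x * x)).re * (τ (star y * y)).re at h
  rw [e, norm_star] at h
  rwa [sq]

theorem aux_cs' {τ : C →ₗ[ℂ] ℂ} (hτ : IsTracialState τ) (x y : C) :
    ‖τ (x * y)‖ ^ 2 ≤ (τ (star x * x)).re * (τ (star y * y)).re := by
  have := aux_cs hτ (star x) y
  rwa [star_star, hτ.2.2 x (star x)] at this

theorem aux_par {τ : C →ₗ[ℂ] ℂ} (x y : C) :
    (τ (star (x - y) * (x - y))).re = 2 * (τ (star x * x)).re + 2 * (τ (star y * y)).re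
      - 4 * (τ (star ((1 / 2 : ℂ) • (x + y)) * ((1 / 2 : ℂ) • (x + y)))).re := by
  have e : star ((1 / 2 : ℂ) • (x + y)) * ((1 / 2 : ℂ) • (x + y))
      = (1 / 4 : ℂ) • (star (x + y) * (x + y)) := by
    rw [star_smul, smul_mul_smul_comm]
    congr 1
    simp; norm_num
  rw [e]
  simp only [star_sub, star_add, mul_sub, sub_mul, add_mul, mul_add, map_add, map_sub, map_smul,
    smul_eq_mul, Complex.add_re, Complex.sub_re]
  have h4 : (1 / 4 : ℂ) = ((1 / 4 : ℝ) : ℂ) := by norm_num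
  rw [h4]
  simp only [Complex.re_ofReal_mul, Complex.add_re]
  ring

/-- the limit functional attached to a convex set of positive contractions -/
theorem aux_limit {τ : C →ₗ[ℂ] ℂ} (hτ : IsTracialState τ) (K : Set C) (hK : K.Nonempty)
    (hmid : ∀ x ∈ K, ∀ y ∈ K, (1 / 2 : ℂ) • (x + y) ∈ K) :
    ∃ (c : ℕ → C) (L : C →ₗ[ℂ] ℂ) (M : ℝ), (∀ n, c n ∈ K) ∧
      (∀ x, Tendsto (fun n => τ (c n * x)) atTop (𝓝 (L x))) ∧
      (∀ x, ‖L x‖ ^ 2 ≤ M * (τ (star x * x)).re) ∧ 0 ≤ M ∧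
      (∀ u : C, star u * u = 1 → u * star u = 1 → (∀ k ∈ K, u * k * star u ∈ K) →
        ∀ x, L (x * u) = L (u * x)) := by
  set N : C → ℝ := fun x => (τ (star x * x)).re with hN
  have hN0 : ∀ x, 0 ≤ N x := fun x => (Complex.le_def.1 (hτ.2.1 x)).1
  set d := sInf (N '' K) with hd
  have hbdd : BddBelow (N '' K) := ⟨0, by rintro _ ⟨x, -, rfl⟩; exact hN0 x⟩
  have hle : ∀ x ∈ K, d ≤ N x := fun x hx => csInf_le hbdd ⟨x, hx, rfl⟩
  have hd0 : 0 ≤ d := le_csInf (hK.image N) (by rintro _ ⟨x, -, rfl⟩; exact hN0 x)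
  have hex : ∀ n : ℕ, ∃ x ∈ K, N x < d + 1 / ((n : ℝ) + 1) := by
    intro n
    have hpos : (0 : ℝ) < 1 / ((n : ℝ) + 1) := by positivity
    obtain ⟨_, ⟨x, hx, rfl⟩, h⟩ := exists_lt_of_csInf_lt (hK.image N)
      (show sInf (N '' K) < d + 1 / ((n : ℝ) + 1) by linarith)
    exact ⟨x, hx, h⟩
  choose c hcK hcN using hex
  have hclose : ∀ x ∈ K, ∀ y ∈ K, ∀ ε : ℝ, N x ≤ d + ε → N y ≤ d + ε → N (x - y) ≤ 4 * ε := by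
    intro x hx y hy ε h1 h2
    have := hle _ (hmid x hx y hy)
    have h3 : N (x - y) = 2 * N x + 2 * N y - 4 * N ((1 / 2 : ℂ) • (x + y)) := aux_par x y
    linarith
  have hlim0 : ∀ R : ℝ, Tendsto (fun n : ℕ => Real.sqrt (4 * (1 / ((n : ℝ) + 1)) * R)) atTop (𝓝 0) := by
    intro R
    have h := (tendsto_one_div_add_atTop_nhds_zero_nat (𝕜 := ℝ))
    have h2 := ((h.const_mul 4).mul_const R).sqrt
    simpa using h2
  have hcau : ∀ x, ∃ l, Tendsto (fun n => τ (c n * x)) atTop (𝓝 l) := by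
    intro x
    apply cauchySeq_tendsto_of_complete
    refine cauchySeq_of_le_tendsto_0 (fun n : ℕ => Real.sqrt (4 * (1 / ((n : ℝ) + 1)) * N x)) ?_
      (hlim0 _)
    intro n m k hn hm
    rw [dist_eq_norm, ← map_sub, ← sub_mul]
    apply Real.le_sqrt_of_sq_le
    refine (aux_cs' hτ _ _).trans ?_
    refine mul_le_mul_of_nonneg_right ?_ (hN0 x)
    apply hclose _ (hcK n) _ (hcK m)
    · refine (hcN n).le.trans ?_
      gcongr
    · refine (hcN m).le.trans ?_
      gcongr
  choose l hl using hcau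
  let L : C →ₗ[ℂ] ℂ := linearMapOfTendsto l (fun n => τ ∘ₗ LinearMap.mulLeft ℂ (c n))
    (tendsto_pi_nhds.2 fun x => hl x)
  have hL : ∀ x, Tendsto (fun n => τ (c n * x)) atTop (𝓝 (L x)) := hl
  refine ⟨c, L, d + 1, hcK, hL, ?_, by linarith, ?_⟩
  · intro x
    refine le_of_tendsto ((hL x).norm.pow 2) (Eventually.of_forall fun n => ?_)
    refine (aux_cs' hτ _ _).trans ?_
    refine mul_le_mul_of_nonneg_right ?_ (hN0 x)
    refine (hcN n).le.trans ?_
    gcongr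
    rw [div_le_one (by positivity)]
    linarith [(Nat.cast_nonneg n : (0 : ℝ) ≤ n)]
  · intro u hu hu' huK x
    have h1 := (hL (x * u)).sub (hL (u * x))
    rw [← sub_eq_zero]
    refine tendsto_nhds_unique h1 ?_
    rw [tendsto_zero_iff_norm_tendsto_zero]
    refine squeeze_zero (fun _ => norm_nonneg _) (fun n => ?_) (hlim0 (N (u * x)))
    apply Real.le_sqrt_of_sq_le
    have e : τ (c n * (x * u)) - τ (c n * (u * x))
        = τ ((u * c n * star u - c n) * (u * x)) := by
      have e1 : (u * c n * star u - c n) * (u * x)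
          = u * c n * (star u * u) * x - c n * (u * x) := by noncomm_ring
      rw [e1, hu, map_sub, ← mul_assoc (c n) x u, hτ.2.2 _ u]
      simp [mul_assoc]
    rw [e]
    refine (aux_cs' hτ _ _).trans ?_
    refine mul_le_mul_of_nonneg_right ?_ (hN0 _)
    apply hclose _ (huK _ (hcK n)) _ (hcK n) _ _ (hcN n).le
    refine le_trans (le_of_eq ?_) (hcN n).le
    change (τ _).re = (τ _).re
    have e2 : star (u * c n * star u) * (u * c n * star u)
        = u * (star (c n) * (star u * u) * c n * star u) := by
      simp [mul_assoc]
    rw [e2, hτ.2.2 u, hu]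
    simp [mul_assoc, hu]

/-- An extremal trace: a dominated trace is a multiple. -/
theorem aux_ext {τ : C →ₗ[ℂ] ℂ} (hτ : IsExtremeTracialState τ) (L : C →ₗ[ℂ] ℂ)
    (htr : ∀ x y, L (x * y) = L (y * x)) (hpos : ∀ x, 0 ≤ L (star x * x))
    (hle : ∀ x, L (star x * x) ≤ τ (star x * x)) (t : ℝ) (ht : L 1 = t) (h0 : 0 < t)
    (h1 : t < 1) (x : C) : L x = t * τ x := by
  have ht0 : (t : ℂ) ≠ 0 := by exact_mod_cast h0.ne'
  have ht1 : (1 - (t : ℂ)) ≠ 0 := by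
    have : (1 - t : ℝ) ≠ 0 := by linarith
    exact_mod_cast this
  have p0 : (0 : ℂ) ≤ (t : ℂ)⁻¹ := by
    rw [← Complex.ofReal_inv]; exact_mod_cast (inv_pos.2 h0).le
  have p1 : (0 : ℂ) ≤ (1 - (t : ℂ))⁻¹ := by
    rw [← Complex.ofReal_one, ← Complex.ofReal_sub, ← Complex.ofReal_inv]
    exact_mod_cast (inv_pos.2 (sub_pos.2 h1)).le
  have key := hτ.2 ((t : ℂ)⁻¹ • L) ((1 - (t : ℂ))⁻¹ • (τ - L))
    ⟨by simp [ht, ht0], fun a => by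
      simpa using mul_nonneg p0 (hpos a), fun a b => by simp [htr a b]⟩
    ⟨by simp [ht, ht1, hτ.1.1], fun a => by
      simpa using mul_nonneg p1 (sub_nonneg.2 (hle a)), fun a b => by
        simp [htr a b, hτ.1.2.2 a b]⟩ t h0 h1
    (fun x => by
      simp only [LinearMap.smul_apply, LinearMap.sub_apply, smul_eq_mul]
      field_simp
      ring)
  have := LinearMap.congr_fun key x
  simp only [LinearMap.smul_apply, LinearMap.sub_apply, smul_eq_mul] at this
  field_simp at this
  linear_combination this

end helpers

theorem aux_main {A B C : Type*} [CStarAlgebra A] [CStarAlgebra B] [CStarAlgebra C]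
    (ιA : A →⋆ₐ[ℂ] C) (ιB : B →⋆ₐ[ℂ] C)
    (hcomm : ∀ (a : A) (b : B), ιA a * ιB b = ιB b * ιA a)
    (hdense : Dense (↑(Submodule.span ℂ {x : C | ∃ (a : A) (b : B), x = ιA a * ιB b}) : Set C))
    (τ : C →ₗ[ℂ] ℂ) (hτ : IsExtremeTracialState τ) (b : B)
    (hb : ∀ x : C, 0 ≤ τ (ιB b * (star x * x)) ∧ τ (ιB b * (star x * x)) ≤ τ (star x * x))
    (t : ℝ) (ht : τ (ιB b) = t) (h0 : 0 < t) (h1 : t < 1) (a : A) :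
    τ (ιA a * ιB b) = τ (ιA a) * τ (ιB b) := by
  have htr := hτ.1.2.2
  let K : Set C := {c | (∀ a, c * ιA a = ιA a * c) ∧
    (∀ x : C, 0 ≤ τ (c * (star x * x)) ∧ τ (c * (star x * x)) ≤ τ (star x * x)) ∧
    ∀ a, τ (c * ιA a) = τ (ιB b * ιA a)}
  have hbK : ιB b ∈ K := ⟨fun a => (hcomm a b).symm, hb, fun _ => rfl⟩
  have hmid : ∀ x ∈ K, ∀ y ∈ K, (1 / 2 : ℂ) • (x + y) ∈ K := by
    rintro x ⟨hx1, hx2, hx3⟩ y ⟨hy1, hy2, hy3⟩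
    have hhalf : (0 : ℂ) ≤ 1 / 2 := by
      have : (1 / 2 : ℂ) = ((1 / 2 : ℝ) : ℂ) := by norm_num
      rw [this]; exact_mod_cast (by norm_num : (0 : ℝ) ≤ 1 / 2)
    refine ⟨fun a => ?_, fun z => ?_, fun a => ?_⟩
    · rw [smul_mul_assoc, mul_smul_comm, add_mul, mul_add, hx1, hy1]
    · rw [smul_mul_assoc, add_mul, map_smul, map_add, smul_eq_mul]
      refine ⟨mul_nonneg hhalf (add_nonneg (hx2 z).1 (hy2 z).1), ?_⟩
      refine (mul_le_mul_of_nonneg_left (add_le_add (hx2 z).2 (hy2 z).2) hhalf).trans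
        (le_of_eq ?_)
      ring
    · rw [smul_mul_assoc, add_mul, map_smul, map_add, smul_eq_mul, hx3, hy3]
      ring
  obtain ⟨c, L, M, hcK, hL, hLM, hM0, hLu⟩ := aux_limit hτ.1 K ⟨_, hbK⟩ hmid
  have hconj : ∀ v : B, star v * v = 1 → v * star v = 1 → ∀ k ∈ K,
      ιB v * k * star (ιB v) ∈ K := by
    rintro v hv hv' k ⟨hk1, hk2, hk3⟩
    have hu : star (ιB v) * ιB v = 1 := by rw [← map_star, ← map_mul, hv, map_one]
    have hu' : ιB v * star (ιB v) = 1 := by rw [← map_star, ← map_mul, hv', map_one]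
    have hc1 : ∀ a, ιA a * ιB v = ιB v * ιA a := fun a => hcomm a v
    have hc2 : ∀ a, ιA a * star (ιB v) = star (ιB v) * ιA a := fun a => by
      rw [← map_star]; exact hcomm a _
    generalize ιB v = u at *
    refine ⟨fun a => ?_, fun z => ?_, fun a => ?_⟩
    · rw [mul_assoc, ← hc2, ← mul_assoc, mul_assoc u k, hk1, ← mul_assoc, ← hc1]
      simp only [mul_assoc]
    · have e : τ (u * k * star u * (star z * z)) = τ (k * (star (z * u) * (z * u))) := by
        rw [mul_assoc, mul_assoc, htr u]
        simp [mul_assoc]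
      have e' : τ (star (z * u) * (z * u)) = τ (star z * z) := by
        rw [star_mul, mul_assoc, htr, mul_assoc, mul_assoc, hu', mul_one]
      rw [e, ← e']
      exact hk2 _
    · rw [← hk3 a, mul_assoc, ← hc2, mul_assoc, htr u, mul_assoc, mul_assoc, hu, mul_one]
  -- continuity
  have hLcont : Continuous L := by
    refine AddMonoidHomClass.continuous_of_bound L (Real.sqrt M) fun x => ?_
    have hx : (τ (star x * x)).re ≤ ‖x‖ ^ 2 := by
      obtain ⟨w, hw⟩ := aux_bound x
      have e := congrArg τ hw
      rw [map_add, map_smul, hτ.1.1] at e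
      have e2 := congrArg Complex.re e
      have hw0 := (Complex.le_def.1 (hτ.1.2.1 w)).1
      rw [Complex.add_re, smul_eq_mul, mul_one, Complex.ofReal_re] at e2
      simp only [Complex.zero_re] at hw0
      linarith
    refine (sq_le_sq₀ (norm_nonneg _) (by positivity)).1 ?_
    rw [mul_pow, Real.sq_sqrt hM0]
    exact (hLM x).trans (mul_le_mul_of_nonneg_left hx hM0)
  -- traciality
  have hLA : ∀ (a : A) (x : C), L (x * ιA a) = L (ιA a * x) := by
    intro a x
    refine tendsto_nhds_unique (hL _) ?_
    refine (hL _).congr fun n => ?_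
    rw [← mul_assoc, (hcK n).1, mul_assoc, htr, mul_assoc]
  have hLB : ∀ (b : B) (x : C), L (x * ιB b) = L (ιB b * x) := by
    intro b
    have hmem : b ∈ Submodule.span ℂ (unitary B : Set B) := by
      rw [CStarAlgebra.span_unitary]; trivial
    induction hmem using Submodule.span_induction with
    | mem v hv =>
      have hv := Unitary.mem_iff.1 hv
      exact hLu _ (by rw [← map_star, ← map_mul, hv.1, map_one])
        (by rw [← map_star, ← map_mul, hv.2, map_one]) (hconj v hv.1 hv.2)
    | zero => simp
    | add x y _ _ hx hy => intro z; simp [mul_add, add_mul, hx, hy]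
    | smul r x _ hx => intro z; simp [hx]
  have hLtr : ∀ x y, L (x * y) = L (y * x) := by
    intro x y
    have hcl : IsClosed {y | L (x * y) = L (y * x)} :=
      isClosed_eq (hLcont.comp (continuous_const.mul continuous_id))
        (hLcont.comp (continuous_id.mul continuous_const))
    have hsub : (↑(Submodule.span ℂ {x : C | ∃ (a : A) (b : B), x = ιA a * ιB b}) : Set C)
        ⊆ {y | L (x * y) = L (y * x)} := by
      intro y hy
      induction hy using Submodule.span_induction with
      | mem y hy =>
        obtain ⟨a, b, rfl⟩ := hy
        change L _ = L _
        rw [← mul_assoc, hLB, ← mul_assoc, hLA, mul_assoc]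
      | zero => simp
      | add y z _ _ hy hz =>
        simp only [Set.mem_ofPred_eq] at *
        simp [mul_add, add_mul, hy, hz]
      | smul r y _ hy =>
        simp only [Set.mem_ofPred_eq] at *
        simp [hy]
    have := closure_minimal hsub hcl (hdense y)
    exact this
  have hLa : ∀ a, L (ιA a) = τ (ιB b * ιA a) := by
    intro a
    refine tendsto_nhds_unique (hL _) ?_
    simp only [(hcK _).2.2 a]
    exact tendsto_const_nhds
  have hL1 : L 1 = t := by
    have := hLa 1
    rwa [map_one, mul_one, ht] at this
  have := aux_ext hτ L hLtr
    (fun x => ge_of_tendsto (hL _) (Filter.Eventually.of_forall fun n => ((hcK n).2.1 x).1))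
    (fun x => le_of_tendsto (hL _) (Filter.Eventually.of_forall fun n => ((hcK n).2.1 x).2))
    t hL1 h0 h1 (ιA a)
  rw [hcomm, ← hLa, this, ht, mul_comm]

theorem aux_full {A B C : Type*} [CStarAlgebra A] [CStarAlgebra B] [CStarAlgebra C]
    (ιA : A →⋆ₐ[ℂ] C) (ιB : B →⋆ₐ[ℂ] C)
    (hcomm : ∀ (a : A) (b : B), ιA a * ιB b = ιB b * ιA a)
    (hdense : Dense (↑(Submodule.span ℂ {x : C | ∃ (a : A) (b : B), x = ιA a * ιB b}) : Set C))
    (τ : C →ₗ[ℂ] ℂ) (hτ : IsExtremeTracialState τ) (a : A) (b : B) :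
    τ (ιA a * ιB b) = τ (ιA a) * τ (ιB b) := by
  have htr := hτ.1.2.2
  have hmem : b ∈ Submodule.span ℂ {b : B | ∃ r s : B, b = star r * r ∧ 1 - b = star s * s} := by
    rw [aux_span]; trivial
  induction hmem using Submodule.span_induction with
  | zero => simp
  | add x y _ _ hx hy => simp [mul_add, hx, hy]
  | smul r x _ hx => simp [hx]; ring
  | mem b hb =>
    obtain ⟨r, s, hr, hs⟩ := hb
    have hsq : ∀ (r : B) (x : C), 0 ≤ τ (ιB (star r * r) * (star x * x)) := by
      intro r x
      have := hτ.1.2.1 (x * star (ιB r))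
      convert this using 1
      rw [map_mul ιB, map_star, star_mul, star_star, mul_assoc, htr]
      simp only [mul_assoc]
    have hb0 : ∀ x : C, 0 ≤ τ (ιB b * (star x * x)) := fun x => by rw [hr]; exact hsq r x
    have hb1 : ∀ x : C, τ (ιB b * (star x * x)) ≤ τ (star x * x) := fun x => by
      have := hsq s x
      rw [← hs, map_sub, map_one, sub_mul, one_mul, map_sub] at this
      exact sub_nonneg.1 this
    have q0 := hb0 1
    have q1 := hb1 1
    simp only [star_one, mul_one, hτ.1.1] at q0 q1
    rw [Complex.le_def] at q0 q1
    have hre : τ (ιB b) = ((τ (ιB b)).re : ℂ) := by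
      apply Complex.ext <;> simp
      simpa using q0.2.symm
    set t := (τ (ιB b)).re with htdef
    have q0 := q0.1
    have q1 := q1.1
    simp only [Complex.zero_re, Complex.one_re] at q0 q1
    have hb'e : ∀ y : C, τ (ιB ((1 / 4 : ℂ) • 1 + (1 / 2 : ℂ) • b) * y)
        = ((1 / 4 : ℝ) : ℂ) * τ y + ((1 / 2 : ℝ) : ℂ) * τ (ιB b * y) := by
      intro y
      rw [map_add, map_smul, map_smul, map_one, add_mul, smul_mul_assoc, smul_mul_assoc,
        one_mul, map_add, map_smul, map_smul]
      push_cast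
      rfl
    have h4 : (0 : ℂ) ≤ ((1 / 4 : ℝ) : ℂ) := by exact_mod_cast (by norm_num : (0 : ℝ) ≤ 1 / 4)
    have h2 : (0 : ℂ) ≤ ((1 / 2 : ℝ) : ℂ) := by exact_mod_cast (by norm_num : (0 : ℝ) ≤ 1 / 2)
    have hval := hb'e 1
    rw [mul_one, mul_one, hτ.1.1, hre] at hval
    have key := aux_main ιA ιB hcomm hdense τ hτ ((1 / 4 : ℂ) • 1 + (1 / 2 : ℂ) • b)
      (fun x => by
        rw [hb'e]
        refine ⟨add_nonneg (mul_nonneg h4 (hτ.1.2.1 x)) (mul_nonneg h2 (hb0 x)), ?_⟩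
        have e1 := mul_le_mul_of_nonneg_left (hb1 x) h2
        have e2 := mul_nonneg h4 (hτ.1.2.1 x)
        rw [← sub_nonneg] at e1 ⊢
        have e3 := add_nonneg e1 e2
        convert e3 using 1
        push_cast
        ring)
      (1 / 4 + 1 / 2 * t) (by rw [hval]; push_cast; ring) (by linarith) (by linarith) a
    rw [hval, hcomm, hb'e] at key
    rw [hcomm, hre]
    push_cast at key
    linear_combination 2 * key

/-- Let `A`, `B` be unital C*-algebras and `τ` an extremal tracial state on a C*-tensor
product `C = A ⊗ B` (realized by commuting unital embeddings `ιA, ιB` with dense joint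
span).  Then `τ` is the product of its restrictions:
`τ(a ⊗ b) = τ(a ⊗ 1) · τ(1 ⊗ b)` for all `a ∈ A`, `b ∈ B`. -/
theorem stmt_11 {A B C : Type*}
    [NormedRing A] [StarRing A] [CStarRing A] [NormedAlgebra ℂ A] [StarModule ℂ A]
    [CompleteSpace A]
    [NormedRing B] [StarRing B] [CStarRing B] [NormedAlgebra ℂ B] [StarModule ℂ B]
    [CompleteSpace B]
    [NormedRing C] [StarRing C] [CStarRing C] [NormedAlgebra ℂ C] [StarModule ℂ C]
    [CompleteSpace C]
    (ιA : A →⋆ₐ[ℂ] C) (ιB : B →⋆ₐ[ℂ] C)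
    (hcomm : ∀ (a : A) (b : B), ιA a * ιB b = ιB b * ιA a)
    (hdense : Dense (↑(Submodule.span ℂ {x : C | ∃ (a : A) (b : B), x = ιA a * ιB b}) : Set C))
    (τ : C →ₗ[ℂ] ℂ) (hτ : IsExtremeTracialState τ) :
    ∀ (a : A) (b : B), τ (ιA a * ιB b) = τ (ιA a) * τ (ιB b) := by
  letI iA : CStarAlgebra A := {}
  letI iB : CStarAlgebra B := {}
  letI iC : CStarAlgebra C := {}
  exact aux_full ιA ιB hcomm hdense τ hτ
end
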